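/- Let d be a positive integer and let U, V ⊆ (ℤ/4)^{d+1} be subsets of size 2^d each. Then | E[ Re( (1−i)·i^{u·v} ) | u ← U, v ← V uniform and independent ] | ≤ 2 · η(V)^{1/4}, where u·v denotes the dot product in ℤ/4 and η(V) is the linearity coefficient of V. -/

import Mathlib

/-- The well-defined power `i^w` of the imaginary unit by an element `w ∈ ℤ/4`. -/
noncomputable def ipow (w : ZMod 4) : ℂ := Complex.I ^ w.val

/-- The linearity coefficient `η(S)` of a finite subset `S` of an abelian group:
`P[x+y = z+w ∣ x,y,z,w ← S uniform] / P[x = y ∣ x,y ← S uniform]`. -/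
noncomputable def linCoeffSet {α : Type*} [AddCommGroup α] [DecidableEq α] (S : Finset α) : ℝ :=
  ((((S ×ˢ S ×ˢ S ×ˢ S).filter
      (fun q => q.1 + q.2.1 = q.2.2.1 + q.2.2.2)).card : ℝ) / (S.card : ℝ) ^ 4) /
    ((((S ×ˢ S).filter (fun q => q.1 = q.2)).card : ℝ) / (S.card : ℝ) ^ 2)

open scoped ComplexConjugate

theorem ipow_zero : ipow 0 = 1 := by simp [ipow]

theorem ipow_add (a b : ZMod 4) : ipow (a + b) = ipow a * ipow b := by
  simp only [ipow, ← pow_add, ZMod.val_add]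
  exact (Complex.I_pow_eq_pow_mod _).symm

theorem ipow_sum {ι : Type*} (s : Finset ι) (f : ι → ZMod 4) :
    ipow (∑ j ∈ s, f j) = ∏ j ∈ s, ipow (f j) := by
  classical
  induction s using Finset.induction_on with
  | empty => simp [ipow_zero]
  | insert a s ha ih => rw [Finset.sum_insert ha, Finset.prod_insert ha, ipow_add, ih]

theorem ipow_values : ipow 0 = 1 ∧ ipow 1 = Complex.I ∧ ipow 2 = -1 ∧ ipow 3 = -Complex.I :=
  ⟨by simp [ipow], by simp [ipow, ZMod.val_one''],
    by rw [ipow, show (2 : ZMod 4).val = 2 from rfl, Complex.I_sq],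
    by rw [ipow, show (3 : ZMod 4).val = 3 from rfl, Complex.I_pow_three]⟩

theorem conj_ipow (a : ZMod 4) : conj (ipow a) = ipow (-a) := by
  obtain ⟨h0, h1, h2, h3⟩ := ipow_values
  have h : a = 0 ∨ a = 1 ∨ a = 2 ∨ a = 3 := by revert a; decide
  rcases h with rfl | rfl | rfl | rfl
  · simp [h0]
  · rw [show (-1 : ZMod 4) = 3 from rfl, h1, h3, Complex.conj_I]
  · rw [show (-2 : ZMod 4) = 2 from rfl, h2, map_neg, map_one]
  · rw [show (-3 : ZMod 4) = 1 from rfl, h1, h3, map_neg, Complex.conj_I, neg_neg]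

theorem sum_ipow_mul (a : ZMod 4) : ∑ t : ZMod 4, ipow (t * a) = if a = 0 then 4 else 0 := by
  obtain ⟨h0, h1, h2, h3⟩ := ipow_values
  have hs (f : ZMod 4 → ℂ) : ∑ t, f t = f 0 + f 1 + f 2 + f 3 := Fin.sum_univ_four f
  have h : a = 0 ∨ a = 1 ∨ a = 2 ∨ a = 3 := by revert a; decide
  rw [hs]
  rcases h with rfl | rfl | rfl | rfl
  · simp [h0]; norm_num
  · rw [if_neg (by decide)]
    simp [h0, h1, h2, h3]
  · rw [if_neg (by decide), show (2 * 2 : ZMod 4) = 0 from rfl, show (3 * 2 : ZMod 4) = 2 from rfl]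
    simp [h0, h2]
  · rw [if_neg (by decide), show (2 * 3 : ZMod 4) = 2 from rfl, show (3 * 3 : ZMod 4) = 1 from rfl]
    simp [h0, h1, h2, h3]

/-- Orthogonality of characters on `(ℤ/4)^ι`. -/
theorem sum_ipow_dotProduct {ι : Type*} [Fintype ι] [DecidableEq ι] (a : ι → ZMod 4) :
    ∑ u : ι → ZMod 4, ipow (∑ j, u j * a j) = if a = 0 then 4 ^ Fintype.card ι else 0 := by
  simp_rw [ipow_sum]
  rw [← Fintype.piFinset_univ, ← Finset.prod_univ_sum (fun _ : ι => (Finset.univ : Finset (ZMod 4)))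
    (fun j t => ipow (t * a j))]
  simp_rw [sum_ipow_mul]
  split_ifs with h
  · simp [h]
  · obtain ⟨j, hj⟩ := Function.ne_iff.mp h
    exact Finset.prod_eq_zero (Finset.mem_univ j) (if_neg hj)

/-- The fourth moment of the Fourier transform of `V` counts additive quadruples in `V`. -/
theorem sum_norm_sum_ipow_pow_four {ι : Type*} [Fintype ι] [DecidableEq ι]
    (V : Finset (ι → ZMod 4)) :
    ∑ u : ι → ZMod 4, ‖∑ v ∈ V, ipow (∑ j, u j * v j)‖ ^ 4 =
      4 ^ Fintype.card ι * (((V ×ˢ V ×ˢ V ×ˢ V).filter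
        (fun q => q.1 + q.2.1 = q.2.2.1 + q.2.2.2)).card : ℝ) := by
  have expand (u : ι → ZMod 4) :
      ((‖∑ v ∈ V, ipow (∑ j, u j * v j)‖ ^ 4 : ℝ) : ℂ) =
        ∑ q ∈ V ×ˢ V ×ˢ V ×ˢ V,
          ipow (∑ j, u j * (q.1 + q.2.1 - (q.2.2.1 + q.2.2.2)) j) := by
    set F := ∑ v ∈ V, ipow (∑ j, u j * v j) with hF
    have hc : conj F = ∑ v ∈ V, ipow (-∑ j, u j * v j) := by
      rw [hF, map_sum]
      simp_rw [conj_ipow]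
    have h4 : ((‖F‖ ^ 4 : ℝ) : ℂ) = F * (F * (conj F * conj F)) := by
      have := Complex.mul_conj' F
      push_cast
      linear_combination (-(‖F‖ : ℂ) ^ 2 - F * conj F) * this
    rw [h4, hc, hF]
    simp_rw [Finset.sum_mul_sum, Finset.mul_sum, Finset.sum_product]
    refine Finset.sum_congr rfl fun x _ => Finset.sum_congr rfl fun y _ =>
      Finset.sum_congr rfl fun z _ => Finset.sum_congr rfl fun w _ => ?_
    simp_rw [← ipow_add]
    congr 1
    simp only [← Finset.sum_neg_distrib, ← Finset.sum_add_distrib]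
    refine Finset.sum_congr rfl fun j _ => ?_
    simp only [Pi.add_apply, Pi.sub_apply]
    ring
  apply Complex.ofReal_injective
  rw [Complex.ofReal_sum]
  simp_rw [expand]
  rw [Finset.sum_comm]
  simp_rw [sum_ipow_dotProduct, sub_eq_zero]
  rw [← Finset.sum_filter, Finset.sum_const, nsmul_eq_mul]
  push_cast
  ring

theorem linCoeffSet_eq {α : Type*} [AddCommGroup α] [DecidableEq α] (S : Finset α)
    (hS : S.Nonempty) :
    linCoeffSet S = (((S ×ˢ S ×ˢ S ×ˢ S).filter
      (fun q => q.1 + q.2.1 = q.2.2.1 + q.2.2.2)).card : ℝ) / (S.card : ℝ) ^ 3 := by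
  have hd : ((S ×ˢ S).filter (fun q => q.1 = q.2)).card = S.card := by
    rw [← Finset.diag_eq_filter, Finset.diag_card]
  have h0 : (S.card : ℝ) ≠ 0 := by exact_mod_cast hS.card_pos.ne'
  rw [linCoeffSet, hd]
  field_simp

theorem abs_re_one_sub_I_mul_pow_four_le (z : ℂ) :
    |((1 - Complex.I) * z).re| ^ 4 ≤ 4 * ‖z‖ ^ 4 := by
  have h : ((1 - Complex.I) * z).re ^ 2 ≤ 2 * ‖z‖ ^ 2 := by
    rw [Complex.sq_norm, Complex.normSq_apply]
    simp only [Complex.mul_re, Complex.sub_re, Complex.sub_im, Complex.one_re, Complex.one_im,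
      Complex.I_re, Complex.I_im]
    nlinarith [sq_nonneg (z.re - z.im)]
  calc |((1 - Complex.I) * z).re| ^ 4 = (((1 - Complex.I) * z).re ^ 2) ^ 2 := by
        rw [← sq_abs (((1 - Complex.I) * z).re), ← pow_mul]
    _ ≤ (2 * ‖z‖ ^ 2) ^ 2 := by gcongr
    _ = 4 * ‖z‖ ^ 4 := by ring

/-- For `U, V ⊆ (ℤ/4)^{d+1}` of size `2^d` each,
`|E[Re((1−i)·i^{u·v}) ∣ u ← U, v ← V]| ≤ 2·η(V)^{1/4}`. -/
theorem stmt_11 (d : ℕ) (hd : 0 < d) (U V : Finset (Fin (d + 1) → ZMod 4))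
    (hU : U.card = 2 ^ d) (hV : V.card = 2 ^ d) :
    |(∑ u ∈ U, ∑ v ∈ V, ((1 - Complex.I) * ipow (∑ j, u j * v j)).re) /
        ((U.card : ℝ) * (V.card : ℝ))| ≤
      2 * linCoeffSet V ^ ((1 : ℝ) / 4) := by
  have key : |∑ u ∈ U, ∑ v ∈ V, ((1 - Complex.I) * ipow (∑ j, u j * v j)).re| ^ 4 ≤
      (2 ^ d) ^ 3 * (4 * (4 ^ (d + 1) * (((V ×ˢ V ×ˢ V ×ˢ V).filter
        (fun q => q.1 + q.2.1 = q.2.2.1 + q.2.2.2)).card : ℝ))) := by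
    simp_rw [← Complex.re_sum, ← Finset.mul_sum]
    calc _ ≤ (∑ u ∈ U, |((1 - Complex.I) * ∑ v ∈ V, ipow (∑ j, u j * v j)).re|) ^ 4 := by
          rw [Finset.mul_sum, Complex.re_sum]
          gcongr
          exact Finset.abs_sum_le_sum_abs _ _
      _ ≤ (U.card : ℝ) ^ 3 *
            ∑ u ∈ U, |((1 - Complex.I) * ∑ v ∈ V, ipow (∑ j, u j * v j)).re| ^ 4 :=
          pow_sum_le_card_mul_sum_pow (fun _ _ => abs_nonneg _) 3
      _ ≤ (U.card : ℝ) ^ 3 * ∑ u ∈ U, 4 * ‖∑ v ∈ V, ipow (∑ j, u j * v j)‖ ^ 4 := by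
          gcongr
          exact abs_re_one_sub_I_mul_pow_four_le _
      _ ≤ (U.card : ℝ) ^ 3 * ∑ u : Fin (d + 1) → ZMod 4, 4 * ‖∑ v ∈ V, ipow (∑ j, u j * v j)‖ ^ 4 := by
          gcongr
          exact Finset.subset_univ U
      _ = _ := by
          rw [← Finset.mul_sum, sum_norm_sum_ipow_pow_four, hU, Fintype.card_fin]
          push_cast
          rfl
  have hη := linCoeffSet_eq V (Finset.card_pos.mp (by rw [hV]; positivity))
  have hη0 : 0 ≤ linCoeffSet V := by rw [hη]; positivity
  refine le_of_pow_le_pow_left₀ four_ne_zero (by positivity) ?_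
  have hr : (linCoeffSet V ^ ((1 : ℝ) / 4)) ^ 4 = linCoeffSet V := by
    rw [← Real.rpow_natCast, ← Real.rpow_mul hη0]
    norm_num
  rw [mul_pow, hr, hη, abs_div, div_pow, hU, hV]
  push_cast
  rw [abs_of_pos (by positivity : (0 : ℝ) < 2 ^ d * 2 ^ d), div_le_iff₀ (by positivity)]
  refine key.trans_eq ?_
  rw [pow_succ (4 : ℝ) d,
    show (4 : ℝ) ^ d = (2 ^ d) ^ 2 by rw [← pow_mul, mul_comm, pow_mul]; norm_num]
  field_simp
  ring
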